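/- Let R and S be rings and let i : R → S and ε : S → R be ring homomorphisms with ε ∘ i = id_R. Then: (1) ε maps the set of nilpotents of S onto the set of nilpotents of R, the set of units of S onto the set of units of R, and the set of idempotents of S onto the set of idempotents of R; (2) if S is a UWNC ring, then R is a UWNC ring; (3) if R is a UWNC ring and every element of the kernel of ε is nilpotent, then S is a UWNC ring. -/

import Mathlib

/-- An element of a ring is *weakly nil-clean* if it is `e + n` or `-e + n`
for an idempotent `e` and a nilpotent `n`. -/
def IsWeaklyNilClean {R : Type*} [Ring R] (a : R) : Prop :=
  ∃ e n : R, IsIdempotentElem e ∧ IsNilpotent n ∧ (a = e + n ∨ a = -e + n)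

/-- An element of a ring is *nil-clean* if it is `e + n`
for an idempotent `e` and a nilpotent `n`. -/
def IsNilClean {R : Type*} [Ring R] (a : R) : Prop :=
  ∃ e n : R, IsIdempotentElem e ∧ IsNilpotent n ∧ a = e + n

/-- A ring is *UWNC* if every unit is weakly nil-clean. -/
def IsUWNC (R : Type*) [Ring R] : Prop :=
  ∀ u : Rˣ, IsWeaklyNilClean (u : R)

/-- A ring is *UNC* if every unit is nil-clean. -/
def IsUNC (R : Type*) [Ring R] : Prop :=
  ∀ u : Rˣ, IsNilClean (u : R)

/-- A ring is *WUU* if every unit is of the form `n + 1` or `n - 1`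
for a nilpotent `n`. -/
def IsWUU (R : Type*) [Ring R] : Prop :=
  ∀ u : Rˣ, ∃ n : R, IsNilpotent n ∧ ((u : R) = n + 1 ∨ (u : R) = n - 1)

theorem RingHom.isNilpotent_of_map_of_ker {R S : Type*} [Ring R] [Ring S] {f : S →+* R}
    (hf : ∀ x ∈ RingHom.ker f, IsNilpotent x) {x : S} (hx : IsNilpotent (f x)) :
    IsNilpotent x := by
  obtain ⟨k, hk⟩ := hx
  obtain ⟨m, hm⟩ := hf (x ^ k) (by rw [RingHom.mem_ker, map_pow, hk])
  exact ⟨k * m, by rw [pow_mul, hm]⟩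

theorem IsWeaklyNilClean.map {R S : Type*} [Ring R] [Ring S] (f : S →+* R) {a : S}
    (ha : IsWeaklyNilClean a) : IsWeaklyNilClean (f a) := by
  obtain ⟨e, n, he, hn, ha⟩ := ha
  refine ⟨f e, f n, he.map f, hn.map f, ?_⟩
  rcases ha with rfl | rfl
  · exact Or.inl (map_add f e n)
  · exact Or.inr (by rw [map_add, map_neg])

theorem retract_isUWNC {R S : Type*} [Ring R] [Ring S] (i : R →+* S) (ε : S →+* R)
    (h : ε.comp i = RingHom.id R) :
    (ε '' {x : S | IsNilpotent x} = {x : R | IsNilpotent x} ∧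
      ε '' {x : S | IsUnit x} = {x : R | IsUnit x} ∧
      ε '' {x : S | IsIdempotentElem x} = {x : R | IsIdempotentElem x}) ∧
    (IsUWNC S → IsUWNC R) ∧
    (IsUWNC R → (∀ x ∈ RingHom.ker ε, IsNilpotent x) → IsUWNC S) := by
  have hε : ∀ r, ε (i r) = r := fun r ↦ RingHom.congr_fun h r
  refine ⟨⟨?_, ?_, ?_⟩, fun hS u ↦ ?_, fun hR hker u ↦ ?_⟩
  · exact Set.Subset.antisymm (Set.image_subset_iff.2 fun _ hx ↦ IsNilpotent.map hx ε)
      fun r hr ↦ ⟨i r, IsNilpotent.map hr i, hε r⟩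
  · exact Set.Subset.antisymm (Set.image_subset_iff.2 fun _ hx ↦ IsUnit.map ε hx)
      fun r hr ↦ ⟨i r, IsUnit.map i hr, hε r⟩
  · exact Set.Subset.antisymm (Set.image_subset_iff.2 fun _ hx ↦ IsIdempotentElem.map hx ε)
      fun r hr ↦ ⟨i r, IsIdempotentElem.map hr i, hε r⟩
  · simpa [hε] using (hS (Units.map (i : R →* S) u)).map ε
  · obtain ⟨e, n, he, hn, hu⟩ := hR (Units.map (ε : S →* R) u)
    replace hu : ε u = e + n ∨ ε u = -e + n := hu
    rcases hu with hu | hu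
    · refine ⟨i e, u - i e, he.map i, RingHom.isNilpotent_of_map_of_ker hker ?_,
        Or.inl (by abel)⟩
      rwa [map_sub, hε, hu, add_sub_cancel_left]
    · refine ⟨i e, u + i e, he.map i, RingHom.isNilpotent_of_map_of_ker hker ?_,
        Or.inr (by abel)⟩
      rwa [map_add, hε, hu, neg_add_cancel_comm]
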